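/- arXiv:1302.0380 — 4 statements merged into one kernel-verified Lean document; each statement's English description precedes it below -/
import Mathlib

section
/- For every n ≥ 1, choice for subsets of the unit interval of cardinality exactly n is topologically Weihrauch reducible to closed choice on the discrete space of natural numbers: C_{[0,1],#=n} ≤_W C_ℕ. -/
/-! Framework: represented spaces, realizers, (strong) topological Weihrauch reducibility. -/

/-- Baire space ℕ^ℕ (with the product topology). -/
abbrev Baire : Type := ℕ → ℕ

/-- A standard pairing ⟨p, q⟩ on Baire space (interleaving). -/
def pairB (p q : Baire) : Baire := fun n => if n % 2 = 0 then p (n / 2) else q (n / 2)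

/-- A representation of `X`: the name relation of a partial map from Baire space to `X`
(`R p x` means that `p` is a name of `x`). -/
structure RepSp (X : Type*) where
  R : Baire → X → Prop

/-- Restriction of a representation to names in `A` (used for restrictions `f_A`). -/
def RepSp.restrict {X : Type*} (δ : RepSp X) (A : Set Baire) : RepSp X :=
  ⟨fun p x => δ.R p x ∧ p ∈ A⟩

/-- `F` is a realizer of the multivalued function `f` (whose domain is
`{x | (f x).Nonempty}`) with respect to the given representations. -/
def Realizes {X Y : Type*} (δX : RepSp X) (δY : RepSp Y) (f : X → Set Y)
    (F : Baire → Baire) : Prop :=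
  ∀ p x, δX.R p x → (f x).Nonempty → ∃ y ∈ f x, δY.R (F p) y

/-- Topological Weihrauch reducibility `f ≤_W g`: there are continuous partial functions
`H` (pre-processor) and `K` (post-processor) on Baire space such that
`p ↦ K⟨p, G (H p)⟩` realizes `f` for every realizer `G` of `g`. -/
def WRed {X Y U V : Type*} (δX : RepSp X) (δY : RepSp Y) (δU : RepSp U) (δV : RepSp V)
    (f : X → Set Y) (g : U → Set V) : Prop :=
  ∃ (H K : Baire → Baire) (dH dK : Set Baire), ContinuousOn H dH ∧ ContinuousOn K dK ∧
    ∀ G : Baire → Baire, Realizes δU δV g G →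
      ∀ p x, δX.R p x → (f x).Nonempty →
        p ∈ dH ∧ pairB p (G (H p)) ∈ dK ∧
          ∃ y ∈ f x, δY.R (K (pairB p (G (H p)))) y

/-- Strong topological Weihrauch reducibility `f ≤_sW g`:
`K ∘ G ∘ H` realizes `f` for every realizer `G` of `g`. -/
def SWRed {X Y U V : Type*} (δX : RepSp X) (δY : RepSp Y) (δU : RepSp U) (δV : RepSp V)
    (f : X → Set Y) (g : U → Set V) : Prop :=
  ∃ (H K : Baire → Baire) (dH dK : Set Baire), ContinuousOn H dH ∧ ContinuousOn K dK ∧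
    ∀ G : Baire → Baire, Realizes δU δV g G →
      ∀ p x, δX.R p x → (f x).Nonempty →
        p ∈ dH ∧ G (H p) ∈ dK ∧ ∃ y ∈ f x, δY.R (K (G (H p))) y

/-! Negative representation of closed subsets of a separable metric space with a
fixed dense sequence, Cauchy representation of points, and choice principles. -/

/-- An enumeration of the nonnegative rationals (as reals): `n ↦ a/(b+1)` with `(a,b)` = unpair. -/
noncomputable def ratCode (n : ℕ) : ℝ := (n.unpair.1 : ℝ) / ((n.unpair.2 : ℝ) + 1)

/-- The rational open ball of `X` coded by `n` (center from the dense sequence `α`,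
rational radius; radius `0` yields the empty ball, allowing padding). -/
noncomputable def ballCode {X : Type*} [MetricSpace X] (α : ℕ → X) (n : ℕ) : Set X :=
  Metric.ball (α n.unpair.1) (ratCode n.unpair.2)

/-- The negative representation `ψ₋` of closed sets: a name `p` enumerates rational open
balls and denotes `X` minus their union. -/
noncomputable def psiMinus {X : Type*} [MetricSpace X] (α : ℕ → X) (p : Baire) : Set X :=
  {x | ∀ i, x ∉ ballCode α (p i)}

/-- The represented space `A(X)` of closed subsets of `X` (negative information). -/
noncomputable def closedRep {X : Type*} [MetricSpace X] (α : ℕ → X) : RepSp (Set X) :=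
  ⟨fun p A => A = psiMinus α p⟩

/-- The Cauchy representation of points of `X` (w.r.t. the dense sequence `α`). -/
noncomputable def pointRep {X : Type*} [MetricSpace X] (α : ℕ → X) : RepSp X :=
  ⟨fun p x => ∀ i, dist x (α (p i)) < (2:ℝ)⁻¹ ^ i⟩

/-- Closed choice restricted to a class `𝔄` of sets: the multivalued map `A ↦ A` with
domain the nonempty members of `𝔄`. -/
def choiceFn {X : Type*} (𝔄 : Set (Set X)) : Set X → Set X :=
  fun A => {x | A ∈ 𝔄 ∧ x ∈ A}

/-- The class of (finite) sets of cardinality exactly `n`. -/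
def cardEqClass (X : Type*) (n : ℕ) : Set (Set X) := {A | A.Finite ∧ A.ncard = n}

/-- The class of nonempty (finite) sets of cardinality at most `n`. -/
def cardLeClass (X : Type*) (n : ℕ) : Set (Set X) :=
  {A | A.Finite ∧ A.Nonempty ∧ A.ncard ≤ n}

/-- The unit cube `[0,1]^n` inside `ℝ^n`. -/
def unitCube (n : ℕ) : Set (Fin n → ℝ) := Set.univ.pi fun _ => Set.Icc (0:ℝ) 1

/-- The class of nonempty closed convex subsets of the unit cube `[0,1]^n`. -/
def convexClass (n : ℕ) : Set (Set (Fin n → ℝ)) :=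
  {A | A.Nonempty ∧ IsClosed A ∧ Convex ℝ A ∧ A ⊆ unitCube n}

/-! Discrete spaces, Cantor space, products, composition, fractals. -/

/-- Cantor space `{0,1}^ℕ`, with the standard (first-difference) metric, whose topology
is the product topology. -/
noncomputable instance : MetricSpace (ℕ → Bool) := PiNat.metricSpace

/-- Representation of closed subsets of the discrete space `Fin k`:
a name enumerates the complement (`0` codes "nothing", `m+1` codes `m`). -/
def finSetRep (k : ℕ) : RepSp (Set (Fin k)) :=
  ⟨fun p A => A = {m : Fin k | ∀ i, p i ≠ (m : ℕ) + 1}⟩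

/-- Representation of points of the discrete space `Fin k`: `p` names `m` iff `p 0 = m`. -/
def finPointRep (k : ℕ) : RepSp (Fin k) := ⟨fun p m => p 0 = (m : ℕ)⟩

/-- Representation of closed subsets of the discrete space `ℕ`:
a name enumerates the complement (`0` codes "nothing", `m+1` codes `m`). -/
def natSetRep : RepSp (Set ℕ) := ⟨fun p A => A = {m : ℕ | ∀ i, p i ≠ m + 1}⟩

/-- Representation of points of the discrete space `ℕ`: `p` names `m` iff `p 0 = m`. -/
def natPointRep : RepSp ℕ := ⟨fun p m => p 0 = m⟩

/-- The `i`-th component of a name of an `n`-tuple (interleaving `n` streams). -/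
def projB (n : ℕ) (i : Fin n) (p : Baire) : Baire := fun k => p (k * n + i)

/-- Representation of `n`-tuples: a name codes `n` names, interleaved. -/
def piRep {X : Type*} (n : ℕ) (δ : RepSp X) : RepSp (Fin n → X) :=
  ⟨fun p x => ∀ i, δ.R (projB n i p) (x i)⟩

/-- The `n`-fold parallel product `f^n` of a multivalued function. -/
def piFn {X Y : Type*} (n : ℕ) (f : X → Set Y) : (Fin n → X) → Set (Fin n → Y) :=
  fun x => {y | ∀ i, y i ∈ f (x i)}

/-- Composition `g ∘ h` of multivalued functions: defined on those `t ∈ dom h` with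
`h t ⊆ dom g`, mapping `t` to `⋃ {g u | u ∈ h t}`. -/
def mcomp {T U V : Type*} (g : U → Set V) (h : T → Set U) : T → Set V :=
  fun t => {v | (h t).Nonempty ∧ (∀ u ∈ h t, (g u).Nonempty) ∧ ∃ u ∈ h t, v ∈ g u}

/-- `f` is a fractal: there is a multivalued `g` on a represented space with nonempty
carrier such that for every clopen `A` of Baire space the restriction `g_A` of `g` to
inputs with names in `A` is Weihrauch equivalent to `f`, or to the nowhere defined
function `0` (i.e. `g_A` has empty domain). -/
def Fractal {X Y : Type*} (δX : RepSp X) (δY : RepSp Y) (f : X → Set Y) : Prop :=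
  ∃ (Z W : Type) (δZ : RepSp Z) (δW : RepSp W) (g : Z → Set W), Nonempty Z ∧
    ∀ A : Set Baire, IsClopen A →
      (WRed (δZ.restrict A) δW δX δY g f ∧ WRed δX δY (δZ.restrict A) δW f g)
      ∨ ¬ ∃ p z, δZ.R p z ∧ p ∈ A ∧ (g z).Nonempty

/-- `f` is a closed fractal: as `Fractal`, with the witnessing representation total. -/
def ClosedFractal {X Y : Type*} (δX : RepSp X) (δY : RepSp Y) (f : X → Set Y) : Prop :=
  ∃ (Z W : Type) (δZ : RepSp Z) (δW : RepSp W) (g : Z → Set W), Nonempty Z ∧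
    (∀ p : Baire, ∃ z, δZ.R p z) ∧
    ∀ A : Set Baire, IsClopen A →
      (WRed (δZ.restrict A) δW δX δY g f ∧ WRed δX δY (δZ.restrict A) δW f g)
      ∨ ¬ ∃ p z, δZ.R p z ∧ p ∈ A ∧ (g z).Nonempty

/-- `X_ε(𝔄)`: the closure (in Baire space) of the set of `ψ₋`-names of sets `A ∈ 𝔄` such
that for every `x ∈ X` some `B ∈ 𝔄` satisfies `B ⊆ A \ B(x, ε)`. -/
noncomputable def Xeps {X : Type*} [MetricSpace X] (α : ℕ → X) (𝔄 : Set (Set X))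
    (ε : ℝ) : Set Baire :=
  closure {p | psiMinus α p ∈ 𝔄 ∧
    ∀ x : X, ∃ B ∈ 𝔄, B ⊆ psiMinus α p \ Metric.ball x ε}

/-- The represented space `ℝ_>`: a name is a nonincreasing sequence of rationals
converging to `x` (approximation from above). -/
noncomputable def gtRep : RepSp ℝ :=
  ⟨fun p x => (∀ i, ((Denumerable.ofNat ℚ (p (i+1)) : ℚ) : ℝ) ≤ ((Denumerable.ofNat ℚ (p i) : ℚ) : ℝ)) ∧
    Filter.Tendsto (fun i => ((Denumerable.ofNat ℚ (p i) : ℚ) : ℝ)) Filter.atTop (nhds x)⟩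

/-- A compact set covered by an open set and an enumerated family of balls is covered by the
open set and finitely many of these balls. -/
theorem IsCompact.exists_finite_ballCode_cover {X : Type*} [MetricSpace X] {α : ℕ → X}
    {B V : Set X} (hB : IsCompact B) (hV : IsOpen V) (p : Baire)
    (h : ∀ x ∈ B, (∃ l, x ∈ ballCode α (p l)) ∨ x ∈ V) :
    ∃ s, ∀ x ∈ B, (∃ l : Fin s, x ∈ ballCode α (p l)) ∨ x ∈ V := by
  obtain ⟨s, hs⟩ := hB.elim_directed_cover
    (fun s : ℕ => (⋃ l : Fin s, ballCode α (p l)) ∪ V)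
    (fun s => (isOpen_iUnion fun _ => Metric.isOpen_ball).union hV)
    (fun x hx => by
      rcases h x hx with ⟨l, hl⟩ | hx
      · exact Set.mem_iUnion.2 ⟨l + 1, Or.inl (Set.mem_iUnion.2 ⟨⟨l, l.lt_succ_self⟩, hl⟩)⟩
      · exact Set.mem_iUnion.2 ⟨0, Or.inr hx⟩)
    (Monotone.directed_le fun s t hst => Set.union_subset_union_left _ <|
      Set.iUnion_subset fun l => Set.subset_iUnion_of_subset (Fin.castLE hst l) subset_rfl)
  exact ⟨s, fun x hx => (hs hx).imp Set.mem_iUnion.1 id⟩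

/-- Least-witness search through a sequence of clopen conditions is continuous where it
terminates. -/
theorem continuousOn_sInf_of_isClopen {Z : Type*} [TopologicalSpace Z] {P : ℕ → Z → Prop}
    (hP : ∀ i, IsClopen {z | P i z}) :
    ContinuousOn (fun z => sInf {i | P i z}) {z | ∃ i, P i z} := by
  intro z hz
  set m := sInf {i | P i z} with hm
  have hmz : P m z := Nat.sInf_mem (s := {i | P i z}) hz
  have hlt : ∀ i ∈ Set.Iio m, ∀ᶠ w in nhds z, ¬ P i w := fun i hi =>
    (hP i).isClosed.isOpen_compl.mem_nhds (Nat.notMem_of_lt_sInf hi)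
  have hev : ∀ᶠ w in nhds z, sInf {i | P i w} = m := by
    filter_upwards [(hP m).isOpen.mem_nhds hmz,
      (Filter.eventually_all_finite (Set.finite_Iio m)).2 hlt] with w hw hw'
    refine le_antisymm (Nat.sInf_le hw) (le_of_not_gt fun hlt => ?_)
    exact hw' _ hlt (Nat.sInf_mem (s := {i | P i w}) ⟨m, hw⟩)
  exact ContinuousAt.continuousWithinAt
    ((continuousAt_const (y := m)).congr (hev.mono fun w hw => hw.symm))

/-- The closed ball with code `c`: center `α c.1` and radius `1 / (c.2 + 1)`. -/
def codedClosedBall {X : Type*} [MetricSpace X] (α : ℕ → X) (c : ℕ × ℕ) : Set X :=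
  Metric.closedBall (α c.1) (1 / ((c.2 : ℝ) + 1))

/-- Finitely many distinct points lie in pairwise disjoint coded closed balls. -/
theorem exists_pairwise_disjoint_codedClosedBall {X ι : Type*} [MetricSpace X] [Finite ι]
    {α : ℕ → X} (hα : DenseRange α) {x : ι → X} (hx : Function.Injective x) :
    ∃ c : ι → ℕ × ℕ, Pairwise (fun i j => Disjoint (codedClosedBall α (c i))
      (codedClosedBall α (c j))) ∧ ∀ i, x i ∈ codedClosedBall α (c i) := by
  obtain ⟨r, hr⟩ : ∃ r : ℕ, ∀ i j, i ≠ j → 4 * (1 / ((r : ℝ) + 1)) < dist (x i) (x j) := by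
    have h : ∀ i j, ∀ᶠ r : ℕ in Filter.atTop,
        i ≠ j → 4 * (1 / ((r : ℝ) + 1)) < dist (x i) (x j) := by
      intro i j
      by_cases hij : i = j
      · simp [hij]
      · have ht : Filter.Tendsto (fun r : ℕ => 4 * (1 / ((r : ℝ) + 1))) Filter.atTop (nhds 0) := by
          simpa using (tendsto_one_div_add_atTop_nhds_zero_nat (𝕜 := ℝ)).const_mul 4
        exact (ht.eventually_lt_const (dist_pos.2 (hx.ne hij))).mono fun _ h _ => h
    exact (Filter.eventually_all.2 fun i => Filter.eventually_all.2 (h i)).exists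
  have hpos : 0 < 1 / ((r : ℝ) + 1) := by positivity
  choose a ha using fun i => hα.exists_dist_lt (x i) hpos
  refine ⟨fun i => (a i, r), fun i j hij => Set.disjoint_left.2 fun z hzi hzj => ?_,
    fun i => Metric.mem_closedBall.2 (ha i).le⟩
  have hzi' : dist z (α (a i)) ≤ 1 / ((r : ℝ) + 1) := hzi
  have hzj' : dist z (α (a j)) ≤ 1 / ((r : ℝ) + 1) := hzj
  have h1 := dist_triangle4 (x i) (α (a i)) z (x j)
  have h2 := dist_triangle_right z (x j) (α (a j))
  rw [dist_comm (α (a i)) z] at h1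
  linarith [hr i j hij, ha i, ha j]

/-- A set of cardinality `n` meeting each of `n` pairwise disjoint sets meets each of them
in at most one point. -/
theorem subsingleton_inter_of_ncard_eq {X : Type*} {n : ℕ} {A : Set X} (hA : A.Finite)
    (hn : A.ncard = n) {B : Fin n → Set X} (hB : Pairwise (fun i j => Disjoint (B i) (B j)))
    (hAB : ∀ i, (A ∩ B i).Nonempty) (i : Fin n) : (A ∩ B i).Subsingleton := by
  choose y hyA hyB using hAB
  have hinj : Function.Injective y := fun i j hij => by
    by_contra hne
    exact Set.disjoint_left.1 (hB hne) (hyB i) (hij ▸ hyB j)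
  have hrange : Set.range y = A := by
    refine Set.eq_of_subset_of_ncard_le (Set.range_subset_iff.2 hyA) ?_ hA
    rw [Set.ncard_range_of_injective hinj, hn, Nat.card_fin]
  have hkey : ∀ z ∈ A ∩ B i, z = y i := by
    rintro z ⟨hzA, hzB⟩
    obtain ⟨j, rfl⟩ := hrange.symm ▸ hzA
    by_contra hne
    exact Set.disjoint_left.1 (hB fun h => hne (congrArg y h)) (hyB j) hzB
  exact fun z hz w hw => (hkey z hz).trans (hkey w hw).symm

/-- Choice for subsets of cardinality exactly `n` of a compact metric space reduces to closed
choice on `ℕ`. -/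
theorem wRed_choiceFn_cardEqClass {X : Type*} [MetricSpace X] [CompactSpace X] {n : ℕ}
    (hn : 1 ≤ n) {α : ℕ → X} (hα : DenseRange α) :
    WRed (closedRep α) (pointRep α) natSetRep natPointRep
      (choiceFn (cardEqClass X n)) (choiceFn Set.univ) := by
  classical
  obtain ⟨e, he⟩ := exists_surjective_nat (Fin n → ℕ × ℕ)
  have hcpt : ∀ c, IsCompact (codedClosedBall α c) := fun c => Metric.isClosed_closedBall.isCompact
  let i₀ : Fin n := ⟨0, hn⟩
  -- the guess `m` is refuted by the first `s` balls of the name `p`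
  let Bad (m s : ℕ) (p : Baire) : Prop :=
    ¬ Pairwise (fun i j => Disjoint (codedClosedBall α (e m i)) (codedClosedBall α (e m j))) ∨
      ∃ i, ∀ x ∈ codedClosedBall α (e m i), (∃ l : Fin s, x ∈ ballCode α (p l)) ∨ x ∈ (∅ : Set X)
  let P (k t : ℕ) (r : Baire) : Prop :=
    ∀ x ∈ codedClosedBall α (e (r 1) i₀),
      (∃ l : Fin t.unpair.1, x ∈ ballCode α (r (2 * l))) ∨
        x ∈ Metric.ball (α t.unpair.2) ((2 : ℝ)⁻¹ ^ k)
  have hBad : ∀ m s, IsClopen {p | Bad m s p} := by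
    intro m s
    have hc : Continuous (fun (p : Baire) (l : Fin s) => p l) := by fun_prop
    exact (isClopen_discrete {q : Fin s → ℕ |
      ¬ Pairwise (fun i j => Disjoint (codedClosedBall α (e m i)) (codedClosedBall α (e m j))) ∨
      ∃ i, ∀ x ∈ codedClosedBall α (e m i),
        (∃ l : Fin s, x ∈ ballCode α (q l)) ∨ x ∈ (∅ : Set X)}).preimage hc
  have hP : ∀ k t, IsClopen {r | P k t r} := by
    intro k t
    have hc : Continuous (fun r : Baire => (r 1, fun l : Fin t.unpair.1 => r (2 * l))) := by
      fun_prop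
    exact (isClopen_discrete {q : ℕ × (Fin t.unpair.1 → ℕ) |
      ∀ x ∈ codedClosedBall α (e q.1 i₀), (∃ l, x ∈ ballCode α (q.2 l)) ∨
        x ∈ Metric.ball (α t.unpair.2) ((2 : ℝ)⁻¹ ^ k)}).preimage hc
  let H (p : Baire) : Baire := fun t => if Bad t.unpair.1 t.unpair.2 p then t.unpair.1 + 1 else 0
  refine ⟨H, fun r k => (sInf {t | P k t r}).unpair.2, Set.univ, {r | ∀ k, ∃ t, P k t r}, ?_, ?_, ?_⟩
  · refine (continuous_pi fun t => ?_).continuousOn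
    exact continuous_const.if (fun p hp => by
      rw [(hBad _ _).frontier_eq] at hp; exact hp.elim) continuous_const
  · refine continuousOn_pi.2 fun k => ?_
    exact (continuous_of_discreteTopology (f := fun t : ℕ => t.unpair.2)).comp_continuousOn
      ((continuousOn_sInf_of_isClopen (hP k)).mono fun r hr => hr k)
  intro G hG p A hpA hne
  have hA : A = psiMinus α p := hpA
  obtain ⟨-, ⟨hfin, hcard⟩, -⟩ := hne
  obtain ⟨m, ⟨-, hm⟩, hGm⟩ := hG (H p) {m | ∀ s, ¬ Bad m s p} (by
    change {m | ∀ s, ¬ Bad m s p} = {m | ∀ t, H p t ≠ m + 1}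
    ext m
    constructor
    · intro h t ht
      by_cases hb : Bad t.unpair.1 t.unpair.2 p
      · simp only [H, hb, if_true, add_left_inj] at ht
        exact h _ (ht ▸ hb)
      · simp [H, hb] at ht
    · intro h s hb
      exact h (Nat.pair m s) (by simp [H, hb])) (by
    have : Finite A := hfin
    obtain ⟨x⟩ : Nonempty (Fin n ≃ A) :=
      ⟨(Finite.equivFinOfCardEq (by rw [← hcard]; rfl)).symm⟩
    obtain ⟨c, hdisj, hmem⟩ := exists_pairwise_disjoint_codedClosedBall hα
      (Subtype.val_injective.comp x.injective)
    obtain ⟨m, rfl⟩ := he c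
    refine ⟨m, trivial, ?_⟩
    rintro s (h | ⟨i, hi⟩)
    · exact h hdisj
    · rcases hi _ (hmem i) with ⟨l, hl⟩ | h
      · have hxi : (x i : X) ∈ psiMinus α p := hA ▸ (x i).2
        exact hxi l hl
      · exact h)
  have hGm' : G (H p) 0 = m := hGm
  have hdisj := not_not.1 fun h => hm 0 (Or.inl h)
  have hmeet : ∀ i, (A ∩ codedClosedBall α (e m i)).Nonempty := by
    intro i
    by_contra hemp
    obtain ⟨s, hs⟩ := (hcpt (e m i)).exists_finite_ballCode_cover isOpen_empty p (α := α)
      fun x hx => Or.inl (by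
        by_contra! hx'
        exact hemp ⟨x, hA ▸ hx', hx⟩)
    exact hm s (Or.inr ⟨i, hs⟩)
  obtain ⟨y, hyA, hyB⟩ := hmeet i₀
  have huniq := subsingleton_inter_of_ncard_eq hfin hcard hdisj hmeet i₀
  have hpP : ∀ k t, P k t (pairB p (G (H p))) ↔ ∀ x ∈ codedClosedBall α (e m i₀),
      (∃ l : Fin t.unpair.1, x ∈ ballCode α (p l)) ∨
        x ∈ Metric.ball (α t.unpair.2) ((2 : ℝ)⁻¹ ^ k) := by
    intro k t
    simp [P, pairB, hGm']
  have hex : ∀ k, ∃ t, P k t (pairB p (G (H p))) := by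
    intro k
    obtain ⟨j, hj⟩ := hα.exists_dist_lt y (show (0 : ℝ) < 2⁻¹ ^ k by positivity)
    obtain ⟨s, hs⟩ := (hcpt (e m i₀)).exists_finite_ballCode_cover
      (Metric.isOpen_ball (x := α j) (ε := (2 : ℝ)⁻¹ ^ k)) p (α := α) fun x hx => by
        by_contra! hx'
        obtain rfl := huniq ⟨hA ▸ hx'.1, hx⟩ ⟨hyA, hyB⟩
        exact hx'.2 hj
    exact ⟨Nat.pair s j, (hpP _ _).2 (by rwa [Nat.unpair_pair])⟩
  refine ⟨trivial, hex, y, ⟨⟨hfin, hcard⟩, hyA⟩, fun k => ?_⟩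
  rcases (hpP _ _).1 (Nat.sInf_mem (hex k)) y hyB with ⟨l, hl⟩ | h
  · have hy : y ∈ psiMinus α p := hA ▸ hyA
    exact (hy l hl).elim
  · exact h

/-- For every n ≥ 1, C_{[0,1],#=n} ≤_W C_ℕ. -/
theorem stmt6 (n : ℕ) (hn : 1 ≤ n) (α : ℕ → ↥(Set.Icc (0:ℝ) 1)) (hα : DenseRange α) :
    WRed (closedRep α) (pointRep α) natSetRep natPointRep
        (choiceFn (cardEqClass ↥(Set.Icc (0:ℝ) 1) n)) (choiceFn Set.univ) :=
  wRed_choiceFn_cardEqClass hn hα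
end

section
/- For every n ≥ 1, choice for nonempty subsets of the unit interval of cardinality at most 2 is not topologically Weihrauch reducible to choice for subsets of the unit interval of cardinality exactly n: C_{[0,1],#≤2} ≰_W C_{[0,1],#=n}. -/
open PiNat Metric Topology

section ChoiceCardinality

theorem ContinuousOn.exists_cylinder {F : Baire → Baire} {d : Set Baire} (hF : ContinuousOn F d)
    {p : Baire} (hp : p ∈ d) (m : ℕ) :
    ∃ k, ∀ p' ∈ d, p' ∈ cylinder p k → F p' ∈ cylinder (F p) m := by
  have h := hF p hp ((isOpen_cylinder (fun _ : ℕ => ℕ) (F p) m).mem_nhds (self_mem_cylinder _ _))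
  obtain ⟨U, hU, hUd⟩ := mem_nhdsWithin_iff_exists_mem_nhds_inter.1 h
  obtain ⟨_, ⟨x, k, rfl⟩, hpx, hxU⟩ :=
    (isTopologicalBasis_cylinders (fun _ : ℕ => ℕ)).mem_nhds_iff.1 hU
  refine ⟨k, fun p' hp' hk => hUd ⟨hxU ?_, hp'⟩⟩
  rw [mem_cylinder_iff] at *
  exact fun i hi => (hk i hi).trans (hpx i hi)

theorem cylinder_subset_cylinder {p p' : Baire} {k m : ℕ} (h : p' ∈ cylinder p k) (hkm : k ≤ m) :
    cylinder p' m ⊆ cylinder p k := by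
  rw [← mem_cylinder_iff_eq.1 h]
  exact cylinder_anti _ hkm

theorem pairB_mem_cylinder {p p' q q' : Baire} {k : ℕ} (hp : p' ∈ cylinder p k)
    (hq : q' ∈ cylinder q k) : pairB p' q' ∈ cylinder (pairB p q) k := by
  rw [mem_cylinder_iff] at *
  intro i hi
  have : i / 2 < k := by omega
  simp only [pairB, hp _ this, hq _ this]

variable {X : Type*} [MetricSpace X]

/-- Upper semicontinuity of the negative representation. -/
theorem exists_cylinder_psiMinus_subset [CompactSpace X] {α : ℕ → X} {p : Baire} {V : Set X}
    (hV : IsOpen V) (hp : psiMinus α p ⊆ V) :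
    ∃ k, ∀ p' ∈ cylinder p k, psiMinus α p' ⊆ V := by
  obtain ⟨t, ht⟩ := hV.isClosed_compl.isCompact.elim_finite_subcover
    (fun i => ballCode α (p i)) (fun i => isOpen_ball) (by
      intro x hx
      by_contra hcon
      exact hx (hp (by simpa [psiMinus] using hcon)))
  obtain ⟨k, hk⟩ := t.exists_nat_subset_range
  refine ⟨k, fun p' hp' x hx => ?_⟩
  by_contra hxV
  obtain ⟨i, hi, hxi⟩ := Set.mem_iUnion₂.1 (ht hxV)
  refine hx i ?_
  rwa [mem_cylinder_iff.1 hp' i (Finset.mem_range.1 (hk hi))]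

theorem exists_pointRep {α : ℕ → X} (hα : DenseRange α) (x : X) : ∃ q, (pointRep α).R q x := by
  choose q hq using fun i : ℕ => hα.exists_dist_lt x (show (0 : ℝ) < 2⁻¹ ^ i by positivity)
  exact ⟨q, hq⟩

/-- Points close to `x` have names sharing a long prefix with a given name of `x`. -/
theorem exists_pointRep_mem_cylinder {α : ℕ → X} (hα : DenseRange α) {x : X} {q : Baire}
    (hq : (pointRep α).R q x) (k : ℕ) :
    ∃ r > 0, ∀ y, dist y x < r → ∃ q' ∈ cylinder q k, (pointRep α).R q' y := by
  have hU : (⋂ i ∈ Finset.range k, ball (α (q i)) ((2 : ℝ)⁻¹ ^ i)) ∈ 𝓝 x :=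
    (Filter.biInter_finset_mem _).2 fun i _ => isOpen_ball.mem_nhds (hq i)
  obtain ⟨r, hr, hrU⟩ := Metric.mem_nhds_iff.1 hU
  refine ⟨r, hr, fun y hy => ?_⟩
  obtain ⟨s, hs⟩ := exists_pointRep hα y
  refine ⟨fun i => if i < k then q i else s i,
    mem_cylinder_iff.2 fun i hi => by simp [hi], fun i => ?_⟩
  by_cases hi : i < k
  · simpa [hi] using Set.mem_iInter₂.1 (hrU (mem_ball.2 hy)) i (Finset.mem_range.2 hi)
  · simpa [hi] using hs i

/-- The closed ball with the center and radius of `ballCode α m`. -/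
noncomputable def closedBallCode (α : ℕ → X) (m : ℕ) : Set X :=
  closedBall (α m.unpair.1) (ratCode m.unpair.2)

/-- No point of the set named by `p` lies on the boundary of a ball enumerated by `p`. -/
def IsOpenName (α : ℕ → X) (p : Baire) : Prop :=
  ∀ i, ∀ x ∈ psiMinus α p, x ∉ closedBallCode α (p i)

theorem exists_mem_ballCode {α : ℕ → X} (hα : DenseRange α) {A : Set X} (hA : IsClosed A) {y : X}
    (hy : y ∉ A) : ∃ m, y ∈ ballCode α m ∧ ∀ x ∈ A, x ∉ closedBallCode α m := by
  obtain ⟨r, hr, hrA⟩ := Metric.mem_nhds_iff.1 (hA.isOpen_compl.mem_nhds hy)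
  obtain ⟨b, hb⟩ := exists_nat_one_div_lt (half_pos hr)
  obtain ⟨j, hj⟩ := hα.exists_dist_lt y (show (0 : ℝ) < 1 / ((b : ℝ) + 1) by positivity)
  refine ⟨Nat.pair j (Nat.pair 1 b), by simpa [ballCode, ratCode] using hj, fun x hx hxm => ?_⟩
  have hxj : dist x (α j) ≤ 1 / ((b : ℝ) + 1) := by simpa [closedBallCode, ratCode] using hxm
  refine hrA (mem_ball.2 ?_) hx
  linarith [dist_triangle_right x y (α j)]

/-- A prefix whose closed balls avoid a closed set `A` extends to an open name of `A`. -/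
theorem exists_isOpenName {α : ℕ → X} (hα : DenseRange α) {A : Set X} (hA : IsClosed A)
    (hne : A ≠ Set.univ) {p : Baire} {k : ℕ}
    (hk : ∀ i < k, ∀ x ∈ A, x ∉ closedBallCode α (p i)) :
    ∃ p' ∈ cylinder p k, IsOpenName α p' ∧ psiMinus α p' = A := by
  classical
  obtain ⟨y, hy⟩ := (Set.ne_univ_iff_exists_notMem A).1 hne
  obtain ⟨m₀, -, hm₀⟩ := exists_mem_ballCode hα hA hy
  set p' : Baire := fun i => if i < k then p i else
    if ∀ x ∈ A, x ∉ closedBallCode α (i - k) then i - k else m₀ with hp'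
  have havoid : ∀ i, ∀ x ∈ A, x ∉ closedBallCode α (p' i) := by
    intro i
    simp only [hp']
    split_ifs with h₁ h₂
    exacts [hk i h₁, h₂, hm₀]
  have hpsi : psiMinus α p' = A := by
    refine Set.Subset.antisymm (fun x hx => ?_) fun x hx i hxi =>
      havoid i x hx (ball_subset_closedBall hxi)
    by_contra hxA
    obtain ⟨m, hxm, hm⟩ := exists_mem_ballCode hα hA hxA
    refine hx (k + m) ?_
    have : p' (k + m) = m := by
      simp only [hp', Nat.add_sub_cancel_left, if_pos hm]
      simp
    rwa [this]
  exact ⟨p', mem_cylinder_iff.2 fun i hi => by simp [hp', hi], by rwa [IsOpenName, hpsi], hpsi⟩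

/-- `q` is a possible value at `p` of a total realizer of choice for sets of cardinality `n`. -/
def IsChoiceAnswer (α : ℕ → X) (n : ℕ) (p q : Baire) : Prop :=
  psiMinus α p ∈ cardEqClass X n → ∃ c ∈ psiMinus α p, (pointRep α).R q c

theorem exists_isChoiceAnswer {α : ℕ → X} (hα : DenseRange α) {n : ℕ} (hn : 1 ≤ n) (p : Baire) :
    ∃ q, IsChoiceAnswer α n p q := by
  by_cases hp : psiMinus α p ∈ cardEqClass X n
  · obtain ⟨c, hc⟩ : (psiMinus α p).Nonempty :=
      Set.nonempty_of_ncard_ne_zero (by have := hp.2; omega)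
    obtain ⟨q, hq⟩ := exists_pointRep hα c
    exact ⟨q, fun _ => ⟨c, hc, hq⟩⟩
  · exact ⟨p, fun h => absurd h hp⟩

/-- `H` and `K` reduce choice for sets of cardinality at most two to choice for sets of
cardinality `n`. -/
structure ReducesChoice (α : ℕ → X) (n : ℕ) (H K : Baire → Baire) (dH dK : Set Baire) :
    Prop where
  continuousOn_pre : ContinuousOn H dH
  continuousOn_post : ContinuousOn K dK
  mem_pre : ∀ p, psiMinus α p ∈ cardLeClass X 2 → p ∈ dH
  mem_post : ∀ p, psiMinus α p ∈ cardLeClass X 2 → ∀ q, IsChoiceAnswer α n (H p) q →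
    pairB p q ∈ dK
  exists_mem : ∀ p, psiMinus α p ∈ cardLeClass X 2 → ∀ q, IsChoiceAnswer α n (H p) q →
    ∃ y ∈ psiMinus α p, (pointRep α).R (K (pairB p q)) y

theorem WRed.exists_reducesChoice {α : ℕ → X} (hα : DenseRange α) {n : ℕ} (hn : 1 ≤ n)
    (h : WRed (closedRep α) (pointRep α) (closedRep α) (pointRep α)
      (choiceFn (cardLeClass X 2)) (choiceFn (cardEqClass X n))) :
    ∃ H K dH dK, ReducesChoice α n H K dH dK := by
  classical
  obtain ⟨H, K, dH, dK, hH, hK, h⟩ := h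
  choose G hG using exists_isChoiceAnswer hα hn
  have key : ∀ p, psiMinus α p ∈ cardLeClass X 2 → ∀ q, IsChoiceAnswer α n (H p) q →
      p ∈ dH ∧ pairB p q ∈ dK ∧
        ∃ y ∈ psiMinus α p, (pointRep α).R (K (pairB p q)) y := by
    intro p hp q hq
    have hreal : Realizes (closedRep α) (pointRep α) (choiceFn (cardEqClass X n))
        (Function.update G (H p) q) := by
      rintro p' _ rfl ⟨_, hp', _⟩
      by_cases hpp : p' = H p
      · subst hpp
        obtain ⟨c, hc, hqc⟩ := hq hp'
        exact ⟨c, ⟨hp', hc⟩, by simpa using hqc⟩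
      · obtain ⟨c, hc, hqc⟩ := hG p' hp'
        exact ⟨c, ⟨hp', hc⟩, by simpa [hpp] using hqc⟩
    obtain ⟨x, hx⟩ := hp.2.1
    obtain ⟨h₁, h₂, y, hy, hy'⟩ := h _ hreal p _ rfl ⟨x, hp, hx⟩
    rw [Function.update_self] at h₂ hy'
    exact ⟨h₁, h₂, y, hy.2, hy'⟩
  refine ⟨H, K, dH, dK, hH, hK, fun p hp => ?_, fun p hp q hq => (key p hp q hq).2.1,
    fun p hp q hq => (key p hp q hq).2.2⟩
  obtain ⟨q, hq⟩ := exists_isChoiceAnswer hα hn (H p)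
  exact (key p hp q hq).1

theorem pair_mem_cardLeClass {Y : Type*} (a b : Y) : ({a, b} : Set Y) ∈ cardLeClass Y 2 :=
  ⟨Set.toFinite _, ⟨a, by simp⟩, by
    simpa using Set.ncard_insert_le a {b}⟩

theorem singleton_mem_cardLeClass {Y : Type*} (a : Y) : ({a} : Set Y) ∈ cardLeClass Y 2 := by
  simpa using pair_mem_cardLeClass a a

variable {α : ℕ → X} {n : ℕ} {H K : Baire → Baire} {dH dK : Set Baire}

theorem ReducesChoice.exists_cylinder_dist_lt (h : ReducesChoice α n H K dH dK) {p q : Baire}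
    (hp : psiMinus α p ∈ cardLeClass X 2) (hq : IsChoiceAnswer α n (H p) q) :
    ∃ y ∈ psiMinus α p, ∀ ε > 0, ∃ k, ∀ p' ∈ cylinder p k, ∀ q' ∈ cylinder q k,
      psiMinus α p' ∈ cardLeClass X 2 → IsChoiceAnswer α n (H p') q' →
        ∃ y' ∈ psiMinus α p', dist y y' < ε := by
  obtain ⟨y, hy, hKy⟩ := h.exists_mem p hp q hq
  refine ⟨y, hy, fun ε hε => ?_⟩
  obtain ⟨i, hi⟩ := exists_pow_lt_of_lt_one (half_pos hε) (show (2 : ℝ)⁻¹ < 1 by norm_num)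
  obtain ⟨k, hk⟩ := h.continuousOn_post.exists_cylinder (h.mem_post p hp q hq) (i + 1)
  refine ⟨k, fun p' hpp' q' hqq' hp' hq' => ?_⟩
  obtain ⟨y', hy', hKy'⟩ := h.exists_mem p' hp' q' hq'
  refine ⟨y', hy', ?_⟩
  have h₁ := hKy i
  have h₂ := hKy' i
  rw [mem_cylinder_iff.1 (hk _ (h.mem_post p' hp' q' hq') (pairB_mem_cylinder hpp' hqq')) i
    (Nat.lt_succ_self i)] at h₂
  linarith [dist_triangle_right y y' (α (K (pairB p q) i))]

/-- If a choice answer `q` at a name `p` of a two-point set leads to a point, then `q` and all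
answers close to it become invalid throughout some cylinder meeting every neighbourhood of `p`. -/
theorem ReducesChoice.exists_not_isChoiceAnswer [CompactSpace X] [Infinite X]
    (hα : DenseRange α) (h : ReducesChoice α n H K dH dK) {p q : Baire} (hp : IsOpenName α p)
    {a b : X} (hab : a ≠ b) (hpab : psiMinus α p = {a, b})
    (hq : IsChoiceAnswer α n (H p) q) :
    ∃ m, ∀ k ≥ m, ∀ δ > 0, ∃ p' ∈ cylinder p k, ∃ k' ≥ k, ∃ z, IsOpenName α p' ∧
      psiMinus α p' = {z} ∧ ∀ p'' ∈ cylinder p' k', psiMinus α p'' ⊆ ball z δ ∧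
        (psiMinus α p'' ∈ cardLeClass X 2 →
          ∀ q' ∈ cylinder q m, ¬ IsChoiceAnswer α n (H p'') q') := by
  obtain ⟨y, hy, hcyl⟩ :=
    h.exists_cylinder_dist_lt (hpab ▸ pair_mem_cardLeClass a b) hq
  obtain ⟨z, hz, hyz⟩ : ∃ z ∈ psiMinus α p, y ≠ z := by
    rw [hpab] at hy ⊢
    rcases hy with rfl | rfl
    exacts [⟨b, by simp, hab⟩, ⟨a, by simp, hab.symm⟩]
  have hε : 0 < dist y z / 2 := half_pos (dist_pos.2 hyz)
  obtain ⟨m, hm⟩ := hcyl _ hε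
  refine ⟨m, fun k hk δ hδ => ?_⟩
  obtain ⟨p', hp', hopen, hpsi⟩ := exists_isOpenName hα (A := {z}) isClosed_singleton
    (fun hu => Set.infinite_univ (hu ▸ Set.finite_singleton z)) (p := p) (k := k)
    (by rintro i - _ rfl; exact hp i _ hz)
  obtain ⟨k', hk'⟩ := exists_cylinder_psiMinus_subset (p := p') (α := α)
    (V := ball z (min δ (dist y z / 2))) isOpen_ball
    (by rw [hpsi, Set.singleton_subset_iff]; exact mem_ball_self (lt_min hδ hε))
  refine ⟨p', hp', max k k', le_max_left _ _, z, hopen, hpsi, fun p'' hp'' => ?_⟩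
  have hsub := hk' p'' (cylinder_anti _ (le_max_right _ _) hp'')
  refine ⟨hsub.trans (ball_subset_ball (min_le_left _ _)), fun hle q' hq' hans => ?_⟩
  have hmem : p'' ∈ cylinder p m := cylinder_anti _ hk
    (cylinder_subset_cylinder hp' (le_max_left k k') hp'')
  obtain ⟨y', hy', hyy'⟩ := hm p'' hmem q' hq' hle hans
  have := (mem_ball.1 (hsub hy')).trans_le (min_le_right _ _)
  linarith [dist_triangle y y' z]

/-- Names in some cylinder are mapped into the domain of choice for cardinality `n`. -/
theorem ReducesChoice.exists_cylinder_mem_cardEqClass [CompactSpace X] [Infinite X]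
    (hα : DenseRange α) (hn : 1 ≤ n) (h : ReducesChoice α n H K dH dK) :
    ∃ p k z, IsOpenName α p ∧ psiMinus α p = {z} ∧
      ∀ p' ∈ cylinder p k, psiMinus α p' ∈ cardLeClass X 2 →
        psiMinus α (H p') ∈ cardEqClass X n := by
  obtain ⟨a, b, hab⟩ := exists_pair_ne X
  obtain ⟨p, -, hp, hpab⟩ := exists_isOpenName hα (A := {a, b}) (Set.toFinite _).isClosed
    (fun hu => Set.infinite_univ (hu ▸ Set.toFinite {a, b})) (p := 0) (k := 0) (by simp)
  obtain ⟨q, hq⟩ := exists_isChoiceAnswer hα hn (H p)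
  obtain ⟨m, hm⟩ := h.exists_not_isChoiceAnswer hα hp hab hpab hq
  obtain ⟨p', -, k', -, z, hp', hz, hcyl⟩ := hm m le_rfl 1 one_pos
  refine ⟨p', k', z, hp', hz, fun p'' hp'' hle => ?_⟩
  by_contra hcon
  exact (hcyl p'' hp'').2 hle q (self_mem_cylinder _ _) fun hmem => absurd hmem hcon

/-- Any cylinder has a subcylinder on which two of the `n` points chosen from are close. -/
theorem ReducesChoice.exists_cylinder_dist_lt_dist_lt [CompactSpace X] [∀ x : X, (𝓝[≠] x).NeBot]
    [Infinite X] (hα : DenseRange α) (hn : 1 ≤ n) (h : ReducesChoice α n H K dH dK)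
    {p : Baire} {k : ℕ} {b : X} (hp : IsOpenName α p) (hpb : psiMinus α p = {b})
    (hdom : ∀ p' ∈ cylinder p k, psiMinus α p' ∈ cardLeClass X 2 →
      psiMinus α (H p') ∈ cardEqClass X n) {ε : ℝ} (hε : 0 < ε) :
    ∃ p' ∈ cylinder p k, ∃ k' > k, ∃ z, IsOpenName α p' ∧ psiMinus α p' = {z} ∧
      ∀ p'' ∈ cylinder p' k', psiMinus α p'' ⊆ ball z ε ∧
        (psiMinus α p'' ∈ cardLeClass X 2 →
          ∃ d ∈ psiMinus α (H p''), ∃ d' ∈ psiMinus α (H p''), d ≠ d' ∧ dist d d' < ε) := by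
  have hU : (⋂ i ∈ Finset.range k, (closedBallCode α (p i))ᶜ) ∈ 𝓝 b :=
    (Filter.biInter_finset_mem _).2 fun i _ =>
      isClosed_closedBall.isOpen_compl.mem_nhds (hp i b (by simp [hpb]))
  obtain ⟨a, haU, hab⟩ := (infinite_of_mem_nhds b hU).exists_notMem_finite (Set.finite_singleton b)
  obtain ⟨p₀, hp₀, hopen₀, hpsi₀⟩ := exists_isOpenName hα (A := {a, b}) (Set.toFinite _).isClosed
    (fun hu => Set.infinite_univ (hu ▸ Set.toFinite {a, b})) (p := p) (k := k) (by
      rintro i hi x (rfl | rfl)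
      · exact Set.mem_iInter₂.1 haU i (Finset.mem_range.2 hi)
      · exact hp i _ (by simp [hpb]))
  have hle₀ : psiMinus α p₀ ∈ cardLeClass X 2 := hpsi₀ ▸ pair_mem_cardLeClass a b
  obtain ⟨hfin, hcard⟩ := hdom p₀ hp₀ hle₀
  obtain ⟨c, hc⟩ : (psiMinus α (H p₀)).Nonempty :=
    Set.nonempty_of_ncard_ne_zero (by omega)
  obtain ⟨q, hq⟩ := exists_pointRep hα c
  obtain ⟨m, hm⟩ := h.exists_not_isChoiceAnswer hα hopen₀ hab hpsi₀ (q := q)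
    fun _ => ⟨c, hc, hq⟩
  obtain ⟨r, hr, hrq⟩ := exists_pointRep_mem_cylinder hα hq m
  have hρ : 0 < min r (ε / 2) := lt_min hr (half_pos hε)
  obtain ⟨l, hl⟩ := exists_cylinder_psiMinus_subset (α := α) (p := H p₀)
    (V := ⋃ e ∈ psiMinus α (H p₀), ball e (min r (ε / 2)))
    (isOpen_biUnion fun _ _ => isOpen_ball)
    fun e he => Set.mem_iUnion₂.2 ⟨e, he, mem_ball_self hρ⟩
  obtain ⟨l', hl'⟩ := h.continuousOn_pre.exists_cylinder (h.mem_pre p₀ hle₀) l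
  obtain ⟨p', hp', k', hk', z, hopen', hz, hcyl⟩ := hm (max (k + 1) (max m l'))
    ((le_max_left _ _).trans (le_max_right _ _)) ε hε
  have hk : k < max (k + 1) (max m l') := lt_of_lt_of_le k.lt_succ_self (le_max_left _ _)
  refine ⟨p', cylinder_subset_cylinder hp₀ hk.le hp', k', hk.trans_le hk', z, hopen', hz,
    fun p'' hp'' => ⟨(hcyl p'' hp'').1, fun hle => ?_⟩⟩
  have hp''₀ : p'' ∈ cylinder p₀ (max (k + 1) (max m l')) :=
    cylinder_subset_cylinder hp' hk' hp''
  have heq := hdom p'' (cylinder_subset_cylinder hp₀ hk.le hp''₀) hle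
  have hsub := hl _ (hl' p'' (h.mem_pre p'' hle)
    (cylinder_anti _ ((le_max_right _ _).trans (le_max_right _ _)) hp''₀))
  have hnear : ∀ d, ∃ e, d ∈ psiMinus α (H p'') →
      e ∈ psiMinus α (H p₀) ∧ dist d e < min r (ε / 2) := by
    intro d
    by_cases hd : d ∈ psiMinus α (H p'')
    · obtain ⟨e, he, hde⟩ := Set.mem_iUnion₂.1 (hsub hd)
      exact ⟨e, fun _ => ⟨he, hde⟩⟩
    · exact ⟨d, fun h => absurd h hd⟩
  choose φ hφ using hnear
  obtain ⟨d, hd, d', hd', hne, heq'⟩ := Set.exists_ne_map_eq_of_ncard_lt_of_maps_to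
    (s := psiMinus α (H p'')) (t := psiMinus α (H p₀) \ {c}) (f := φ)
    (by rw [Set.ncard_sdiff_singleton_of_mem hc, hcard, heq.2]; omega)
    (by
      refine fun d hd => ⟨(hφ d hd).1, fun hdc => ?_⟩
      have hdc : φ d = c := hdc
      obtain ⟨q', hq', hq'd⟩ := hrq d (hdc ▸ (hφ d hd).2.trans_le (min_le_left _ _))
      exact (hcyl p'' hp'').2 hle q' hq' fun _ => ⟨d, hd, hq'd⟩)
    (hfin.subset Set.sdiff_subset)
  refine ⟨d, hd, d', hd', hne, ?_⟩
  have h₁ := (hφ d hd).2.trans_le (min_le_right _ _)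
  have h₂ := (hφ d' hd').2.trans_le (min_le_right _ _)
  rw [← heq'] at h₂
  linarith [dist_triangle_right d d' (φ d)]

theorem not_reducesChoice [CompactSpace X] [∀ x : X, (𝓝[≠] x).NeBot] [Infinite X]
    (hα : DenseRange α) (hn : 1 ≤ n) : ¬ ReducesChoice α n H K dH dK := by
  intro h
  obtain ⟨p₀, k₀, z₀, hopen₀, hz₀, hdom₀⟩ := h.exists_cylinder_mem_cardEqClass hα hn
  let C := {c : Baire × ℕ // (IsOpenName α c.1 ∧ ∃ z, psiMinus α c.1 = {z}) ∧
    ∀ p ∈ cylinder c.1 c.2, psiMinus α p ∈ cardLeClass X 2 →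
      psiMinus α (H p) ∈ cardEqClass X n}
  have hstep : ∀ (j : ℕ) (c : C), ∃ c' : C, c'.1.1 ∈ cylinder c.1.1 c.1.2 ∧ c.1.2 < c'.1.2 ∧
      ∀ p ∈ cylinder c'.1.1 c'.1.2,
        (∃ z, psiMinus α p ⊆ ball z (1 / ((j : ℝ) + 1))) ∧
        (psiMinus α p ∈ cardLeClass X 2 → ∃ d ∈ psiMinus α (H p),
          ∃ d' ∈ psiMinus α (H p), d ≠ d' ∧ dist d d' < 1 / ((j : ℝ) + 1)) := by
    rintro j ⟨⟨p, k⟩, ⟨hopen, z, hz⟩, hdom⟩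
    obtain ⟨p', hp', k', hk', z', hopen', hz', hcyl⟩ :=
      h.exists_cylinder_dist_lt_dist_lt hα hn hopen hz hdom
        (show (0 : ℝ) < 1 / ((j : ℝ) + 1) by positivity)
    exact ⟨⟨(p', k'), ⟨hopen', z', hz'⟩, fun p'' hp'' =>
        hdom p'' (cylinder_subset_cylinder hp' hk'.le hp'')⟩, hp', hk',
      fun p'' hp'' => ⟨⟨z', (hcyl p'' hp'').1⟩, (hcyl p'' hp'').2⟩⟩
  choose next hnext_mem hnext_lt hnext using hstep
  let c : ℕ → C := fun j => Nat.rec ⟨(p₀, k₀), ⟨hopen₀, z₀, hz₀⟩, hdom₀⟩ (fun j c => next j c) j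
  have hc : ∀ j, c (j + 1) = next j (c j) := fun _ => rfl
  have hlen : ∀ j, j ≤ (c j).1.2 := by
    intro j
    induction j with
    | zero => exact Nat.zero_le _
    | succ j ih => exact ih.trans_lt (hc j ▸ hnext_lt j (c j))
  have hmem : ∀ i j, i ≤ j → (c j).1.1 ∈ cylinder (c i).1.1 (c i).1.2 ∧ (c i).1.2 ≤ (c j).1.2 := by
    intro i j hij
    induction j, hij using Nat.le_induction with
    | base => exact ⟨self_mem_cylinder _ _, le_rfl⟩
    | succ j _ ih =>
      rw [hc j]
      exact ⟨cylinder_subset_cylinder ih.1 ih.2 (hnext_mem j (c j)),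
        ih.2.trans (hnext_lt j (c j)).le⟩
  set p : Baire := fun i => (c (i + 1)).1.1 i with hp_def
  have hp : ∀ j, p ∈ cylinder (c j).1.1 (c j).1.2 := by
    refine fun j => mem_cylinder_iff.2 fun i hi => ?_
    rcases le_total j (i + 1) with hij | hij
    · exact mem_cylinder_iff.1 (hmem j (i + 1) hij).1 i hi
    · exact (mem_cylinder_iff.1 (hmem (i + 1) j hij).1 i (hlen (i + 1))).symm
  have hne : (psiMinus α p).Nonempty := by
    by_contra hempty
    obtain ⟨k, hk⟩ := exists_cylinder_psiMinus_subset (α := α) (p := p) isOpen_empty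
      (Set.not_nonempty_iff_eq_empty.1 hempty).subset
    obtain ⟨z, hz⟩ := (c k).2.1.2
    have := hk (c k).1.1 ((mem_cylinder_comm _ _ _).1 (cylinder_anti _ (hlen k) (hp k)))
    simp [hz] at this
  have hpj := fun j => hnext j (c j) p (hc j ▸ hp (j + 1))
  have hsub : (psiMinus α p).Subsingleton := by
    intro x hx y hy
    by_contra hxy
    obtain ⟨j, hj⟩ := exists_nat_one_div_lt (half_pos (dist_pos.2 hxy))
    obtain ⟨z, hz⟩ := (hpj j).1
    linarith [dist_triangle_right x y z, mem_ball.1 (hz hx), mem_ball.1 (hz hy)]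
  obtain ⟨x, hx⟩ := hne
  have hle : psiMinus α p ∈ cardLeClass X 2 := by
    rw [hsub.eq_singleton_of_mem hx]
    exact singleton_mem_cardLeClass x
  have hfin : (psiMinus α (H p)).Finite := (hdom₀ p (hp 0) hle).1
  obtain ⟨d, hd, d', hd', hdd', -⟩ := (hpj 0).2 hle
  obtain ⟨j, hj⟩ := exists_nat_one_div_lt
    (hfin.infsep_pos_iff_nontrivial.2 ⟨d, hd, d', hd', hdd'⟩)
  obtain ⟨e, he, e', he', hee', hdist⟩ := (hpj j).2 hle
  linarith [Set.infsep_le_dist_of_mem he he' hee']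

end ChoiceCardinality

/-- For every n ≥ 1, C_{[0,1],#≤2} ≰_W C_{[0,1],#=n}. -/
theorem stmt7 (n : ℕ) (hn : 1 ≤ n) (α : ℕ → ↥(Set.Icc (0:ℝ) 1)) (hα : DenseRange α) :
    ¬ WRed (closedRep α) (pointRep α) (closedRep α) (pointRep α)
        (choiceFn (cardLeClass ↥(Set.Icc (0:ℝ) 1) 2))
        (choiceFn (cardEqClass ↥(Set.Icc (0:ℝ) 1) n)) := by
  intro h
  have : Infinite ↥(Set.Icc (0:ℝ) 1) := (Set.Icc_infinite zero_lt_one).to_subtype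
  obtain ⟨H, K, dH, dK, hred⟩ := h.exists_reducesChoice hα hn
  exact not_reducesChoice hα hn hred
end

section
/- Let X be a compact metric space with a fixed dense sequence. Then for every n ≥ 1, C_{X,#=n} ≤_sW C_{{0,1}^ℕ,#=n} and C_{X,#≤n} ≤_sW C_{{0,1}^ℕ,#≤n}, i.e., choice for n-point (respectively, at-most-n-point) closed subsets of X is strongly topologically Weihrauch reducible to the corresponding choice principle for Cantor space. -/
open Filter Topology Set

/-- The cylinder sets form a neighbourhood basis in Baire space. -/
theorem Baire.eventually_nhds_iff {P : Baire → Prop} {p : Baire} :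
    (∀ᶠ p' in 𝓝 p, P p') ↔ ∃ t, ∀ p', (∀ i < t, p' i = p i) → P p' := by
  constructor
  · intro h
    obtain ⟨_, ⟨x, t, rfl⟩, hp, hsub⟩ :=
      (PiNat.isTopologicalBasis_cylinders (fun _ : ℕ => ℕ)).mem_nhds_iff.1 h
    refine ⟨t, fun p' hp' => hsub fun i hi => ?_⟩
    rw [hp' i hi, hp i hi]
  · rintro ⟨t, ht⟩
    filter_upwards [(PiNat.isOpen_cylinder (fun _ : ℕ => ℕ) p t).mem_nhds
      (PiNat.self_mem_cylinder p t)] with p' hp'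
    exact ht p' hp'

/-- Each coordinate of Baire space is locally constant. -/
theorem Baire.eventually_apply_eq (p : Baire) (i : ℕ) : ∀ᶠ p' in 𝓝 p, p' i = p i :=
  Baire.eventually_nhds_iff.2 ⟨i + 1, fun _ h => h i i.lt_succ_self⟩

/-- A map into Baire space is continuous on a set if each coordinate is locally constant there. -/
theorem Baire.continuousOn_of_eventually_eq {H : Baire → Baire} {D : Set Baire}
    (h : ∀ p ∈ D, ∀ j, ∀ᶠ p' in 𝓝 p, p' ∈ D → H p' j = H p j) : ContinuousOn H D := by
  refine continuousOn_pi.2 fun j p hp => ?_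
  refine tendsto_const_nhds.congr' ?_
  rw [EventuallyEq, eventually_nhdsWithin_iff]
  filter_upwards [h p hp j] with p' hp' hD
  exact (hp' hD).symm

/-- On a subset of Baire space, witnesses of a locally solvable condition can be selected
in a locally constant way. -/
theorem Baire.exists_locallyConstant_selection {G : Type*} [Nonempty G] (D : Set Baire)
    (P : Baire → G → Prop)
    (h : ∀ p ∈ D, ∃ g, ∀ᶠ p' in 𝓝 p, p' ∈ D → P p' g) :
    ∃ s : Baire → G, ∀ p ∈ D, P p (s p) ∧ ∀ᶠ p' in 𝓝 p, p' ∈ D → s p' = s p := by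
  classical
  let cyl : Baire → ℕ → Set Baire := fun p t => PiNat.cylinder (E := fun _ : ℕ => ℕ) p t
  have cyl_eq : ∀ {p p' : Baire} {t t' : ℕ}, p' ∈ cyl p t → t' ≤ t → cyl p' t' = cyl p t' := by
    intro p p' t t' h h'
    exact PiNat.mem_cylinder_iff_eq.1 (PiNat.cylinder_anti p h' h)
  let good : Set Baire → G → Prop := fun C g => ∀ p' ∈ C, p' ∈ D → P p' g
  let σ : Set Baire → G := fun C => Classical.epsilon (good C)
  let τ : Baire → ℕ := fun p => sInf {t | ∃ g, good (cyl p t) g}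
  have hτ : ∀ p ∈ D, ∃ g, good (cyl p (τ p)) g := by
    intro p hp
    obtain ⟨g, hg⟩ := h p hp
    obtain ⟨t, ht⟩ := Baire.eventually_nhds_iff.1 hg
    exact Nat.sInf_mem (s := {t | ∃ g, good (cyl p t) g}) ⟨t, g, ht⟩
  refine ⟨fun p => σ (cyl p (τ p)), fun p hp => ⟨?_, ?_⟩⟩
  · exact Classical.epsilon_spec (hτ p hp) p (PiNat.self_mem_cylinder _ _) hp
  · refine Baire.eventually_nhds_iff.2 ⟨τ p, fun p' hp' hD => ?_⟩
    have hp' : p' ∈ cyl p (τ p) := hp'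
    have hle : τ p' ≤ τ p := by
      refine Nat.sInf_le ?_
      change ∃ g, good (cyl p' (τ p)) g
      rw [cyl_eq hp' le_rfl]
      exact hτ p hp
    have hge : τ p ≤ τ p' := by
      refine Nat.sInf_le ?_
      change ∃ g, good (cyl p (τ p')) g
      rw [← cyl_eq hp' hle]
      exact hτ p' hD
    change σ (cyl p' (τ p')) = σ (cyl p (τ p))
    rw [le_antisymm hle hge, cyl_eq hp' le_rfl]

theorem ratCode_pair (a b : ℕ) : ratCode (Nat.pair a b) = (a : ℝ) / ((b : ℝ) + 1) := by
  simp [ratCode]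

theorem ballCode_pair {X : Type*} [MetricSpace X] (α : ℕ → X) (i r : ℕ) :
    ballCode α (Nat.pair i r) = Metric.ball (α i) (ratCode r) := by
  simp [ballCode]

theorem ballCode_zero {X : Type*} [MetricSpace X] (α : ℕ → X) : ballCode α 0 = ∅ := by
  simp [ballCode, ratCode]

/-- The coded balls around points of a dense sequence form a neighbourhood basis. -/
theorem exists_ballCode_subset {Y : Type*} [MetricSpace Y] {γ : ℕ → Y} (hγ : DenseRange γ)
    (y : Y) {ε : ℝ} (hε : 0 < ε) : ∃ c, y ∈ ballCode γ c ∧ ballCode γ c ⊆ Metric.ball y ε := by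
  obtain ⟨b, hb⟩ := exists_nat_one_div_lt (half_pos hε)
  have hb0 : (0 : ℝ) < 1 / ((b : ℝ) + 1) := Nat.one_div_pos_of_nat
  obtain ⟨i, hi⟩ := hγ.exists_dist_lt y hb0
  refine ⟨Nat.pair i (Nat.pair 1 b), ?_, ?_⟩
  · rw [ballCode_pair, ratCode_pair, Metric.mem_ball]
    simpa using hi
  · rw [ballCode_pair, ratCode_pair]
    refine Metric.ball_subset_ball' ?_
    rw [dist_comm (γ i) y]
    push_cast
    linarith

/-- A family of sets with relatively closed graph over a subset of Baire space has
continuously computable negative names. -/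
theorem exists_continuous_psiMinus_eq {Y : Type*} [MetricSpace Y] {γ : ℕ → Y}
    (hγ : DenseRange γ) (D : Set Baire) (B : Baire → Set Y)
    (hB : ∀ p ∈ D, ∀ q ∉ B p, ∀ᶠ z : Baire × Y in 𝓝 (p, q), z.1 ∈ D → z.2 ∉ B z.1) :
    ∃ H : Baire → Baire, ContinuousOn H D ∧ ∀ p ∈ D, psiMinus γ (H p) = B p := by
  classical
  let safe : Baire → ℕ → ℕ → Prop := fun p c t =>
    ∀ p' ∈ D, (∀ i < t, p' i = p i) → Disjoint (ballCode γ c) (B p')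
  let H : Baire → Baire := fun p j => if safe p j.unpair.1 j.unpair.2 then j.unpair.1 else 0
  refine ⟨H, ?_, fun p hp => ?_⟩
  · refine Baire.continuousOn_of_eventually_eq fun p _ j => ?_
    refine Baire.eventually_nhds_iff.2 ⟨j.unpair.2, fun p' hp' _ => ?_⟩
    have : safe p' j.unpair.1 j.unpair.2 ↔ safe p j.unpair.1 j.unpair.2 := by
      refine forall₂_congr fun p'' _ => imp_congr_left (forall₂_congr fun i hi => ?_)
      rw [hp' i hi]
    simp only [H, this]
  · ext q
    constructor
    · intro hq
      by_contra hqB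
      obtain ⟨P, hP, Q, hQ, hPQ⟩ := eventually_prod_iff.1 (nhds_prod_eq (x := p) (y := q) ▸ hB p hp q hqB)
      obtain ⟨t, ht⟩ := Baire.eventually_nhds_iff.1 hP
      obtain ⟨ε, hε, hεQ⟩ := Metric.eventually_nhds_iff_ball.1 hQ
      obtain ⟨c, hqc, hc⟩ := exists_ballCode_subset hγ q hε
      have hsafe : safe p c t := fun p' hp' hpp' =>
        Set.disjoint_left.2 fun q' hq' => hPQ (ht p' hpp') (hεQ q' (hc hq')) hp'
      refine hq (Nat.pair c t) ?_
      simpa [H, hsafe] using hqc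
    · intro hq j hj
      by_cases hs : safe p j.unpair.1 j.unpair.2
      · simp only [H, hs, if_true] at hj
        exact Set.disjoint_left.1 (hs p hp fun _ _ => rfl) hj hq
      · simp [H, hs, ballCode_zero] at hj

/-- The membership relation of negatively represented closed sets is closed. -/
theorem eventually_notMem_psiMinus {X : Type*} [MetricSpace X] (α : ℕ → X) {p : Baire} {x : X}
    (h : x ∉ psiMinus α p) : ∀ᶠ z : Baire × X in 𝓝 (p, x), z.2 ∉ psiMinus α z.1 := by
  simp only [psiMinus, mem_ofPred_eq, not_forall, not_not] at h
  obtain ⟨i, hi⟩ := h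
  have h₁ : ∀ᶠ z : Baire × X in 𝓝 (p, x), z.1 i = p i :=
    (Baire.eventually_apply_eq p i).prod_inl_nhds x
  have hball : ∀ᶠ y in 𝓝 x, y ∈ ballCode α (p i) := Metric.isOpen_ball.mem_nhds hi
  have h₂ : ∀ᶠ z : Baire × X in 𝓝 (p, x), z.2 ∈ ballCode α (p i) := hball.prod_inr_nhds p
  filter_upwards [h₁, h₂] with z hz₁ hz₂ hz
  exact hz i (hz₁ ▸ hz₂)

/-- In a compact space, negatively represented closed sets are upper semicontinuous. -/
theorem eventually_psiMinus_subset {X : Type*} [MetricSpace X] [CompactSpace X] (α : ℕ → X)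
    {p : Baire} {W : Set X} (hW : IsOpen W) (h : psiMinus α p ⊆ W) :
    ∀ᶠ p' in 𝓝 p, psiMinus α p' ⊆ W := by
  have : ∀ᶠ p' in 𝓝 p, ∀ x ∈ Wᶜ, x ∉ psiMinus α p' :=
    hW.isClosed_compl.isCompact.eventually_forall_of_forall_eventually fun x hx =>
      eventually_notMem_psiMinus α fun hx' => hx (h hx')
  filter_upwards [this] with p' hp' x hx
  by_contra hxW
  exact hp' x hxW hx

/-- `g` is, near `x`, a constant index of an `ε`-approximation of `x` in the sequence `α`. -/
def IsLocalIndex {X : Type*} [MetricSpace X] (α : ℕ → X) (ε : ℝ) (g : X → ℕ) (x : X) : Prop :=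
  (∀ᶠ y in 𝓝 x, g y = g x) ∧ dist x (α (g x)) < ε

theorem isOpen_isLocalIndex {X : Type*} [MetricSpace X] (α : ℕ → X) (ε : ℝ) (g : X → ℕ) :
    IsOpen {x | IsLocalIndex α ε g x} := by
  refine isOpen_iff_mem_nhds.2 fun x hx => ?_
  have h : ∀ᶠ y in 𝓝 x, dist y (α (g x)) < ε :=
    (continuous_id.dist continuous_const).tendsto x |>.eventually_lt_const hx.2
  filter_upwards [hx.1, hx.1.eventually_nhds, h] with y h₁ h₂ h₃
  exact ⟨by simpa only [h₁] using h₂, by rwa [h₁]⟩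

/-- A finite set admits locally constant indices of approximations. -/
theorem exists_isLocalIndex_of_finite {X : Type*} [MetricSpace X] {α : ℕ → X}
    (hα : DenseRange α) {A : Set X} (hA : A.Finite) {ε : ℝ} (hε : 0 < ε) :
    ∃ g : X → ℕ, ∀ x ∈ A, IsLocalIndex α ε g x := by
  classical
  obtain ⟨U, hU, hdisj⟩ := hA.t2_separation
  choose m hm using fun x => hα.exists_dist_lt x hε
  let g : X → ℕ := fun y => if h : ∃ a ∈ A, y ∈ U a then m h.choose else 0
  have hg : ∀ x ∈ A, ∀ y ∈ U x, g y = m x := by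
    intro x hx y hy
    have h : ∃ a ∈ A, y ∈ U a := ⟨x, hx, hy⟩
    have : h.choose = x :=
      hdisj.elim_set h.choose_spec.1 hx y h.choose_spec.2 hy
    simp only [g, dif_pos h, this]
  refine ⟨g, fun x hx => ⟨?_, ?_⟩⟩
  · filter_upwards [(hU x).2.mem_nhds (hU x).1] with y hy
    rw [hg x hx y hy, hg x hx x (hU x).1]
  · rw [hg x hx x (hU x).1]
    exact hm x

/-- For names of finite closed sets in a compact space, Cauchy names of the points of the set
can be chosen locally constantly in the name of the set and in the point. -/
theorem exists_cauchyName_selection {X : Type*} [MetricSpace X] [CompactSpace X] {α : ℕ → X}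
    (hα : DenseRange α) :
    ∃ s : Baire → X → Baire, ∀ p, (psiMinus α p).Finite →
      (∀ x ∈ psiMinus α p, (pointRep α).R (s p x) x) ∧
      ∀ x ∈ psiMinus α p, ∀ k, ∀ᶠ z : Baire × X in 𝓝 (p, x),
        (psiMinus α z.1).Finite → s z.1 z.2 k = s p x k := by
  have key : ∀ k : ℕ, ∃ s : Baire → X → ℕ, ∀ p ∈ {p | (psiMinus α p).Finite},
      (∀ x ∈ psiMinus α p, IsLocalIndex α ((2 : ℝ)⁻¹ ^ k) (s p) x) ∧
      ∀ᶠ p' in 𝓝 p, p' ∈ {p | (psiMinus α p).Finite} → s p' = s p := by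
    intro k
    refine Baire.exists_locallyConstant_selection _
      (fun p g => ∀ x ∈ psiMinus α p, IsLocalIndex α ((2 : ℝ)⁻¹ ^ k) g x) fun p hp => ?_
    obtain ⟨g, hg⟩ := exists_isLocalIndex_of_finite hα hp (ε := (2 : ℝ)⁻¹ ^ k) (by positivity)
    refine ⟨g, ?_⟩
    filter_upwards [eventually_psiMinus_subset α (isOpen_isLocalIndex α _ g) hg] with p' hp' _
    exact hp'
  choose s hs using key
  refine ⟨fun p x k => s k p x, fun p hp => ⟨fun x hx k => ((hs k p hp).1 x hx).2,
    fun x hx k => ?_⟩⟩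
  filter_upwards [(hs k p hp).2.prod_inl_nhds x,
    ((hs k p hp).1 x hx).1.prod_inr_nhds p] with z h₁ h₂ hz
  rw [h₁ hz, h₂]

/-- The graph of an element of Baire space, as a point of Cantor space. -/
def graphCode (f : Baire) : ℕ → Bool := fun j => decide (f j.unpair.1 = j.unpair.2)

theorem graphCode_pair (f : Baire) (k m : ℕ) :
    graphCode f (Nat.pair k m) = true ↔ f k = m := by
  simp [graphCode]

theorem graphCode_injective : Function.Injective graphCode := fun f g h => by
  funext k
  exact ((graphCode_pair g k (f k)).1 (h ▸ (graphCode_pair f k (f k)).2 rfl)).symm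

/-- The point of Cantor space with the given name, read off diagonally. -/
def diagPoint (γ : ℕ → ℕ → Bool) (r : Baire) : ℕ → Bool := fun j => γ (r j) j

theorem eq_diagPoint {γ : ℕ → ℕ → Bool} {r : Baire} {q : ℕ → Bool}
    (h : (pointRep γ).R r q) : q = diagPoint γ r := by
  funext j
  have hj : dist q (γ (r j)) < (1 / 2 : ℝ) ^ j := by simpa only [one_div] using h j
  exact PiNat.apply_eq_of_dist_lt (E := fun _ => Bool) hj le_rfl

/-- Decoding of `graphCode` is continuous on names of codes. -/
theorem exists_continuous_decoder (γ : ℕ → ℕ → Bool) :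
    ∃ K : Baire → Baire, ContinuousOn K {r | diagPoint γ r ∈ range graphCode} ∧
      ∀ r f, diagPoint γ r = graphCode f → K r = f := by
  classical
  have hK : ∀ r f, diagPoint γ r = graphCode f →
      Function.invFun graphCode (diagPoint γ r) = f := fun r f h => by
    rw [h, Function.leftInverse_invFun graphCode_injective]
  refine ⟨fun r => Function.invFun graphCode (diagPoint γ r), ?_, hK⟩
  refine Baire.continuousOn_of_eventually_eq ?_
  rintro r ⟨f, hf⟩ k
  filter_upwards [Baire.eventually_apply_eq r (Nat.pair k (f k))] with r' hr'
  rintro ⟨f', hf'⟩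
  rw [hK r f hf.symm, hK r' f' hf'.symm]
  refine (graphCode_pair f' k (f k)).1 ?_
  rw [hf', diagPoint, hr', ← (graphCode_pair f k (f k)).2 rfl, hf, diagPoint]

/-- The Cantor space codes of selected Cauchy names of points of a finite closed set form a
family with closed graph. -/
theorem eventually_notMem_image_graphCode {X : Type*} [MetricSpace X] [CompactSpace X]
    {α : ℕ → X} {s : Baire → X → Baire} {p : Baire}
    (hs : ∀ x ∈ psiMinus α p, ∀ k, ∀ᶠ z : Baire × X in 𝓝 (p, x),
        (psiMinus α z.1).Finite → s z.1 z.2 k = s p x k)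
    {q : ℕ → Bool} (hq : q ∉ (fun x => graphCode (s p x)) '' psiMinus α p) :
    ∀ᶠ z : Baire × (ℕ → Bool) in 𝓝 (p, q), (psiMinus α z.1).Finite →
      z.2 ∉ (fun x => graphCode (s z.1 x)) '' psiMinus α z.1 := by
  have key : ∀ᶠ z : Baire × (ℕ → Bool) in 𝓝 (p, q), ∀ x ∈ (univ : Set X),
      (psiMinus α z.1).Finite → x ∈ psiMinus α z.1 → graphCode (s z.1 x) ≠ z.2 := by
    refine isCompact_univ.eventually_forall_of_forall_eventually fun x _ => ?_
    have hproj : Tendsto (fun w : (Baire × (ℕ → Bool)) × X => (w.1.1, w.2))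
        (𝓝 ((p, q), x)) (𝓝 (p, x)) := by
      have : Continuous fun w : (Baire × (ℕ → Bool)) × X => (w.1.1, w.2) := by fun_prop
      exact this.tendsto ((p, q), x)
    by_cases hx : x ∈ psiMinus α p
    · have hne : graphCode (s p x) ≠ q := fun h => hq ⟨x, hx, h⟩
      obtain ⟨j, hj⟩ := Function.ne_iff.1 hne
      have hcoord : ∀ᶠ w : (Baire × (ℕ → Bool)) × X in 𝓝 ((p, q), x), w.1.2 j = q j := by
        have : Continuous fun w : (Baire × (ℕ → Bool)) × X => w.1.2 j :=
          (continuous_apply j).comp (continuous_snd.comp continuous_fst)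
        have h := this.tendsto ((p, q), x)
        rw [nhds_discrete Bool, tendsto_pure] at h
        exact h
      filter_upwards [hproj.eventually (hs x hx j.unpair.1), hcoord] with w h₁ h₂ hfin _ h
      refine hj ?_
      rw [← h₂, ← h, graphCode, graphCode, h₁ hfin]
    · filter_upwards [hproj.eventually (eventually_notMem_psiMinus α hx)] with w hw _ hmem
      exact absurd hmem hw
  filter_upwards [key] with z hz hfin
  rintro ⟨x, hx, h⟩
  exact hz x (mem_univ x) hfin hx h

/-- Closed choice for a class of finite subsets of a compact metric space reduces to closed
choice for a class of subsets of Cantor space containing all injective images. -/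
theorem sWRed_choice_cantor {X : Type*} [MetricSpace X] [CompactSpace X]
    {α : ℕ → X} (hα : DenseRange α) {γ : ℕ → (ℕ → Bool)} (hγ : DenseRange γ)
    {𝔄 : Set (Set X)} {𝔅 : Set (Set (ℕ → Bool))} (hfin : ∀ A ∈ 𝔄, A.Finite)
    (himage : ∀ A ∈ 𝔄, ∀ e : X → (ℕ → Bool), InjOn e A → e '' A ∈ 𝔅) :
    SWRed (closedRep α) (pointRep α) (closedRep γ) (pointRep γ)
      (choiceFn 𝔄) (choiceFn 𝔅) := by
  obtain ⟨s, hs⟩ := exists_cauchyName_selection hα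
  obtain ⟨K, hKcont, hK⟩ := exists_continuous_decoder γ
  obtain ⟨H, hHcont, hH⟩ := exists_continuous_psiMinus_eq hγ {p | (psiMinus α p).Finite}
    (fun p => (fun x => graphCode (s p x)) '' psiMinus α p)
    (fun p hp q hq => eventually_notMem_image_graphCode (hs p hp).2 hq)
  refine ⟨H, K, _, _, hHcont, hKcont, fun G hG p A hpA hne => ?_⟩
  obtain ⟨x₀, hA, hx₀⟩ := hne
  obtain rfl : A = psiMinus α p := hpA
  have hp := hfin _ hA
  have hinj : InjOn (fun x => graphCode (s p x)) (psiMinus α p) := by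
    intro x hx y hy hxy
    have hxy : s p x = s p y := graphCode_injective hxy
    refine dist_le_zero.1 (ge_of_tendsto' (x := atTop)
      (f := fun k : ℕ => (2 : ℝ)⁻¹ ^ k + (2 : ℝ)⁻¹ ^ k) ?_ fun k => ?_)
    · have := tendsto_pow_atTop_nhds_zero_of_lt_one (r := (2 : ℝ)⁻¹) (by norm_num) (by norm_num)
      simpa using this.add this
    · have h₁ := (hs p hp).1 x hx k
      have h₂ := (hs p hp).1 y hy k
      rw [← hxy] at h₂
      exact (dist_triangle_right x y (α (s p x k))).trans (add_le_add h₁.le h₂.le)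
  obtain ⟨q, ⟨-, x, hx, rfl⟩, hq⟩ := hG (H p) _ (hH p hp).symm
    ⟨_, himage _ hA _ hinj, mem_image_of_mem _ hx₀⟩
  have hcode := (eq_diagPoint hq).symm
  refine ⟨hp, ⟨_, hcode.symm⟩, x, ⟨hA, hx⟩, ?_⟩
  rw [hK _ _ hcode]
  exact (hs p hp).1 x hx

/-- For a compact metric space X with dense sequence and n ≥ 1,
C_{X,#=n} ≤_sW C_{{0,1}^ℕ,#=n} and C_{X,#≤n} ≤_sW C_{{0,1}^ℕ,#≤n}. -/
theorem stmt8 {X : Type*} [MetricSpace X] [CompactSpace X]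
    (α : ℕ → X) (hα : DenseRange α) (γ : ℕ → (ℕ → Bool)) (hγ : DenseRange γ)
    (n : ℕ) (hn : 1 ≤ n) :
    SWRed (closedRep α) (pointRep α) (closedRep γ) (pointRep γ)
        (choiceFn (cardEqClass X n)) (choiceFn (cardEqClass (ℕ → Bool) n))
    ∧ SWRed (closedRep α) (pointRep α) (closedRep γ) (pointRep γ)
        (choiceFn (cardLeClass X n)) (choiceFn (cardLeClass (ℕ → Bool) n)) := by
  exact ⟨sWRed_choice_cantor hα hγ (fun _ hA => hA.1) fun A hA e he =>
      ⟨hA.1.image e, he.ncard_image.trans hA.2⟩,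
    sWRed_choice_cantor hα hγ (fun _ hA => hA.1) fun A hA e he =>
      ⟨hA.1.image e, hA.2.1.image e, he.ncard_image.trans_le hA.2.2⟩⟩
end

section
/- Define Lb : {x ∈ ℝ_> | x > 0} → ℕ by Lb(x) = min{n ∈ ℕ | n ≥ 1 and 1/n ≤ x}. Then Lb is strongly topologically Weihrauch equivalent to C_ℕ: Lb ≡_sW C_ℕ. -/
/-- The multivalued function Lb on ℝ_> with domain {x | x > 0},
Lb(x) = min {n | n ≥ 1 ∧ 1/n ≤ x}. -/
noncomputable def LbFn : ℝ → Set ℕ :=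
  fun x => {k | 0 < x ∧ k = sInf {m : ℕ | 1 ≤ m ∧ ((m : ℝ))⁻¹ ≤ x}}

/-- The rational number coded by a natural number. -/
abbrev ratOfNat (n : ℕ) : ℚ := Denumerable.ofNat ℚ n

theorem sInf_inv_le_eq_succ {x : ℝ} {k : ℕ} (h1 : x * k < 1) (h2 : 1 ≤ x * (k + 1)) :
    sInf {m : ℕ | 1 ≤ m ∧ ((m : ℝ))⁻¹ ≤ x} = k + 1 := by
  have hx : 0 < x := by
    by_contra! h
    have : x * ((k : ℝ) + 1) ≤ 0 := mul_nonpos_of_nonpos_of_nonneg h (by positivity)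
    linarith
  refine IsLeast.csInf_eq ⟨⟨by omega, ?_⟩, ?_⟩
  · rw [inv_le_iff_one_le_mul₀ (by positivity)]
    push_cast
    linarith
  · rintro m ⟨hm, hmx⟩
    have hm0 : (0 : ℝ) < m := by exact_mod_cast hm
    rw [inv_le_iff_one_le_mul₀ hm0] at hmx
    by_contra! hlt
    have hmk : (m : ℝ) ≤ k := by exact_mod_cast Nat.lt_succ_iff.mp hlt
    nlinarith

theorem exists_mul_lt_one_le_mul_succ {x : ℝ} (hx : 0 < x) :
    ∃ k : ℕ, x * k < 1 ∧ 1 ≤ x * (k + 1) := by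
  have hex : ∃ k : ℕ, 1 ≤ x * (k + 1) := by
    obtain ⟨n, hn⟩ := exists_nat_ge x⁻¹
    refine ⟨n, ?_⟩
    rw [inv_le_iff_one_le_mul₀ hx] at hn
    nlinarith
  classical
  refine ⟨Nat.find hex, ?_, Nat.find_spec hex⟩
  rcases h : Nat.find hex with _ | k
  · simp
  · have := Nat.find_min hex (m := k) (by omega)
    push_cast
    linarith

/-- `m + 1` if `a * k < 1` or `1 ≤ b * (k + 1)` fails for the first component `k` of `m`, and `0`
otherwise, where `a` and `b` are given by their codes. -/
def excludeCode (m : ℕ) (ab : ℕ × ℕ) : ℕ :=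
  if ratOfNat ab.1 * m.unpair.1 < 1 ∧ 1 ≤ ratOfNat ab.2 * (m.unpair.1 + 1) then 0 else m + 1

/-- Given a name `p` of `x` in `ℝ_>`, enumerates the complement of the set of codes of pairs
`(k, i)` such that the `i`-th approximation witnesses `x < 1 / k` and `1 / (k + 1) ≤ x`. -/
def witnessCompl (p : Baire) : Baire := fun n =>
  excludeCode n.unpair.1 (p n.unpair.1.unpair.2, p n.unpair.2)

theorem continuous_witnessCompl : Continuous witnessCompl :=
  continuous_pi fun n =>
    (continuous_of_discreteTopology (f := excludeCode n.unpair.1)).comp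
      ((continuous_apply n.unpair.1.unpair.2).prodMk (continuous_apply n.unpair.2))

theorem witnessCompl_ne_iff (p : Baire) (m : ℕ) :
    (∀ n, witnessCompl p n ≠ m + 1) ↔
      ratOfNat (p m.unpair.2) * m.unpair.1 < 1 ∧
        ∀ j, 1 ≤ ratOfNat (p j) * (m.unpair.1 + 1) := by
  constructor
  · intro h
    have key : ∀ j, ratOfNat (p m.unpair.2) * m.unpair.1 < 1 ∧
        1 ≤ ratOfNat (p j) * (m.unpair.1 + 1) := by
      intro j
      by_contra hc
      apply h (Nat.pair m j)
      simp only [witnessCompl, excludeCode, Nat.unpair_pair]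
      rw [if_neg hc]
    exact ⟨(key 0).1, fun j => (key j).2⟩
  · rintro ⟨h1, h2⟩ n hn
    unfold witnessCompl excludeCode at hn
    split_ifs at hn with hc
    obtain rfl : n.unpair.1 = m := by omega
    exact hc ⟨h1, h2 _⟩

/-- The least number not yet excluded by the first `i` entries of `p`. -/
noncomputable def leastRemaining (p : Baire) (i : ℕ) : ℕ :=
  sInf {m : ℕ | ∀ j : Fin i, p j ≠ m + 1}

theorem continuous_leastRemaining (i : ℕ) : Continuous fun p => leastRemaining p i :=
  (continuous_of_discreteTopology (f := fun v : Fin i → ℕ =>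
    sInf {m : ℕ | ∀ j : Fin i, v j ≠ m + 1})).comp
    (continuous_pi fun j : Fin i => continuous_apply (A := fun _ : ℕ => ℕ) (j : ℕ))

theorem leastRemaining_ne (p : Baire) (i : ℕ) (j : Fin i) : p j ≠ leastRemaining p i + 1 := by
  have hne : {m : ℕ | ∀ j : Fin i, p j ≠ m + 1}.Nonempty := by
    refine ⟨∑ j : Fin i, p j, fun j => ?_⟩
    have := Finset.single_le_sum (f := fun j : Fin i => p j) (fun _ _ => Nat.zero_le _)
      (Finset.mem_univ j)
    omega
  exact Nat.sInf_mem hne j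

theorem leastRemaining_le {p : Baire} {i m : ℕ} (h : ∀ j < i, p j ≠ m + 1) :
    leastRemaining p i ≤ m :=
  Nat.sInf_le fun j => h j j.2

theorem monotone_leastRemaining (p : Baire) : Monotone (leastRemaining p) :=
  fun _ k hik => leastRemaining_le fun j hj =>
    leastRemaining_ne p k ⟨j, hj.trans_le hik⟩

theorem exists_leastRemaining_eventually_eq {p : Baire} (h : ∃ m, ∀ i, p i ≠ m + 1) :
    ∃ m, (∀ i, p i ≠ m + 1) ∧ ∀ᶠ i in Filter.atTop, leastRemaining p i = m := by
  obtain ⟨b, hb⟩ := h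
  have hbdd : BddAbove (Set.range (leastRemaining p)) :=
    ⟨b, by rintro _ ⟨i, rfl⟩; exact leastRemaining_le fun j _ => hb j⟩
  have hlim := tendsto_atTop_ciSup (monotone_leastRemaining p) hbdd
  rw [nhds_discrete, Filter.tendsto_pure] at hlim
  refine ⟨_, fun i hi => ?_, hlim⟩
  obtain ⟨k, hk, hik⟩ := (hlim.and (Filter.eventually_gt_atTop i)).exists
  exact leastRemaining_ne p k ⟨i, hik⟩ (by rw [hk]; exact hi)

/-- Sends an enumeration of the complement of a nonempty `A ⊆ ℕ` to a name in `ℝ_>` of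
`1 / (min A + 1)`. -/
noncomputable def invLeastRemaining (p : Baire) : Baire := fun i =>
  Denumerable.eqv ℚ ((leastRemaining p i + 1 : ℚ)⁻¹)

theorem continuous_invLeastRemaining : Continuous invLeastRemaining :=
  continuous_pi fun i => (continuous_of_discreteTopology (f := fun m : ℕ =>
    Denumerable.eqv ℚ ((m + 1 : ℚ)⁻¹))).comp (continuous_leastRemaining i)

theorem gtRep_invLeastRemaining {p : Baire} {m : ℕ}
    (h : ∀ᶠ i in Filter.atTop, leastRemaining p i = m) :
    gtRep.R (invLeastRemaining p) ((m + 1 : ℝ)⁻¹) := by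
  have hval : ∀ i, ((Denumerable.ofNat ℚ (invLeastRemaining p i) : ℚ) : ℝ) =
      ((leastRemaining p i : ℝ) + 1)⁻¹ := by
    intro i
    have h : Denumerable.ofNat ℚ (invLeastRemaining p i) = ((leastRemaining p i : ℚ) + 1)⁻¹ :=
      (Denumerable.eqv ℚ).symm_apply_apply _
    rw [h]
    push_cast
    rfl
  refine ⟨fun i => ?_, ?_⟩
  · rw [hval, hval]
    have : (leastRemaining p i : ℝ) ≤ leastRemaining p (i + 1) := by
      exact_mod_cast monotone_leastRemaining p i.le_succ
    gcongr
  · refine tendsto_const_nhds.congr' ?_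
    filter_upwards [h] with i hi
    rw [hval, hi]

theorem LbFn_le_closedChoice :
    SWRed gtRep natPointRep natSetRep natPointRep LbFn (choiceFn Set.univ) := by
  refine ⟨witnessCompl, fun r _ => (r 0).unpair.1 + 1, Set.univ, Set.univ,
    continuous_witnessCompl.continuousOn, ?_, ?_⟩
  · exact (continuous_pi fun _ => (continuous_of_discreteTopology
      (f := fun m : ℕ => m.unpair.1 + 1)).comp (continuous_apply 0)).continuousOn
  rintro G hG p x ⟨hanti, hlim⟩ ⟨_, hx, _⟩
  refine ⟨trivial, trivial, ?_⟩
  have hle : ∀ i, x ≤ (ratOfNat (p i) : ℝ) := (antitone_nat_of_succ_le hanti).le_of_tendsto hlim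
  have hne : (choiceFn Set.univ {m : ℕ | ∀ i, witnessCompl p i ≠ m + 1}).Nonempty := by
    obtain ⟨k, hk1, hk2⟩ := exists_mul_lt_one_le_mul_succ hx
    obtain ⟨i, hi⟩ := ((hlim.mul_const (k : ℝ)).eventually_lt_const hk1).exists
    refine ⟨Nat.pair k i, trivial, ?_⟩
    rw [Set.mem_ofPred_eq, witnessCompl_ne_iff, Nat.unpair_pair]
    refine ⟨by exact_mod_cast hi, fun j => ?_⟩
    have : (1 : ℝ) ≤ ratOfNat (p j) * (k + 1) :=
      hk2.trans (mul_le_mul_of_nonneg_right (hle j) (by positivity))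
    exact_mod_cast this
  obtain ⟨m, ⟨-, hm⟩, hGm⟩ := hG _ _ rfl hne
  rw [Set.mem_ofPred_eq, witnessCompl_ne_iff] at hm
  replace hGm : G (witnessCompl p) 0 = m := hGm
  refine ⟨m.unpair.1 + 1, ⟨hx, (sInf_inv_le_eq_succ ?_ ?_).symm⟩, ?_⟩
  · have h1 : (ratOfNat (p m.unpair.2) : ℝ) * m.unpair.1 < 1 := by exact_mod_cast hm.1
    exact (mul_le_mul_of_nonneg_right (hle _) (by positivity)).trans_lt h1
  · refine ge_of_tendsto' (hlim.mul_const _) fun j => ?_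
    exact_mod_cast hm.2 j
  · simp [natPointRep, hGm]

theorem closedChoice_le_LbFn :
    SWRed natSetRep natPointRep gtRep natPointRep (choiceFn Set.univ) LbFn := by
  refine ⟨invLeastRemaining, fun r _ => r 0 - 1, Set.univ, Set.univ,
    continuous_invLeastRemaining.continuousOn, ?_, ?_⟩
  · exact (continuous_pi fun _ => (continuous_of_discreteTopology
      (f := fun m : ℕ => m - 1)).comp (continuous_apply 0)).continuousOn
  rintro G hG p A rfl ⟨b, -, hb⟩
  refine ⟨trivial, trivial, ?_⟩
  obtain ⟨m, hm, hev⟩ := exists_leastRemaining_eventually_eq ⟨b, hb⟩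
  have hpos : (0 : ℝ) < (m + 1 : ℝ)⁻¹ := by positivity
  obtain ⟨y, ⟨-, hy⟩, hGy⟩ := hG _ _ (gtRep_invLeastRemaining hev) ⟨_, hpos, rfl⟩
  rw [sInf_inv_le_eq_succ (k := m)] at hy
  · replace hGy : G (invLeastRemaining p) 0 = y := hGy
    refine ⟨m, ⟨trivial, hm⟩, ?_⟩
    simp [natPointRep, hGy, hy]
  · rw [inv_mul_lt_iff₀ (by positivity)]
    linarith
  · rw [inv_mul_cancel₀ (by positivity)]

/-- Lb ≡_sW C_ℕ. -/
theorem stmt10 :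
    SWRed gtRep natPointRep natSetRep natPointRep LbFn (choiceFn Set.univ)
    ∧ SWRed natSetRep natPointRep gtRep natPointRep (choiceFn Set.univ) LbFn :=
  ⟨LbFn_le_closedChoice, closedChoice_le_LbFn⟩
end
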